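/- arXiv:1909.11304 — 3 statements merged into one kernel-verified Lean document; each statement's English description precedes it below -/
import Mathlib

section
/- Let n be a positive integer and let x, x' be vectors in ℝ^{D_in}. For the one-hidden-layer linear network f_θ(x) = n^{-1/2} Σ_{i=1}^n V_i (Σ_α U_{iα} x_α) with independent standard Gaussian parameters, the variance over the initialization of the Neural Tangent Kernel Θ_θ(x,x') = Σ_μ (∂f_θ(x)/∂θ^μ)(∂f_θ(x')/∂θ^μ) equals exactly Var[Θ_θ(x,x')] = (‖x‖² ‖x'‖² + 3⟨x,x'⟩²)/n. In particular Var[Θ_θ(x,x')] = O(n^{-1}) as n → ∞. -/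
open MeasureTheory ProbabilityTheory Asymptotics Filter

/-- The standard Gaussian measure on `ι → ℝ`: all coordinates are independent `N(0,1)`. -/
noncomputable def stdGaussian (ι : Type*) [Fintype ι] : Measure (ι → ℝ) :=
  Measure.pi fun _ => gaussianReal 0 1

/-- The one-hidden-layer linear network of width `n`:
`f_θ(x) = n^{-1/2} Σ_i V_i (Σ_α U_{iα} x_α)`. -/
noncomputable def net1 (n D : ℕ) (θ : (Fin n ⊕ Fin n × Fin D) → ℝ) (x : Fin D → ℝ) : ℝ :=
  ((n : ℝ) ^ (-(1 / 2 : ℝ))) *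
    ∑ i : Fin n, θ (Sum.inl i) * ∑ α : Fin D, θ (Sum.inr (i, α)) * x α

/-- The Neural Tangent Kernel `Θ_θ(x,x') = Σ_μ (∂f_θ(x)/∂θ^μ)(∂f_θ(x')/∂θ^μ)`, the sum
running over all parameters `μ`. -/
noncomputable def ntk1 (n D : ℕ) (θ : (Fin n ⊕ Fin n × Fin D) → ℝ) (x x' : Fin D → ℝ) : ℝ :=
  ∑ μ : Fin n ⊕ Fin n × Fin D,
    fderiv ℝ (fun ψ => net1 n D ψ x) θ (Pi.single μ 1) *
      fderiv ℝ (fun ψ => net1 n D ψ x') θ (Pi.single μ 1)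


lemma gm2 (v : NNReal) : ∫ y, y ^ 2 ∂(gaussianReal 0 v) = v := by
  have h := variance_of_integral_eq_zero (X := fun y : ℝ => y) (μ := gaussianReal 0 v)
    (by fun_prop) (by simp)
  rw [variance_fun_id_gaussianReal] at h
  exact h.symm

lemma gm4 (v : NNReal) : ∫ y, y ^ 4 ∂(gaussianReal 0 v) = 3 * (v : ℝ) ^ 2 := by
  have h := iteratedDeriv_mgf_zero (X := id) (μ := gaussianReal 0 v) (by simp) 4
  rw [mgf_id_gaussianReal] at h
  have key : ∀ (a b c d e : ℝ), deriv (fun t : ℝ => (a + b * t + c * t ^ 2 + d * t ^ 3 + e * t ^ 4) * Real.exp (0 * t + v * t ^ 2 / 2))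
      = fun t : ℝ => (b + 2 * c * t + 3 * d * t ^ 2 + 4 * e * t ^ 3 + (a + b * t + c * t ^ 2 + d * t ^ 3 + e * t ^ 4) * (v * t)) * Real.exp (0 * t + v * t ^ 2 / 2) := by
    intro a b c d e
    ext t
    have h1 : HasDerivAt (fun t : ℝ => a + b * t + c * t ^ 2 + d * t ^ 3 + e * t ^ 4)
        (b + 2 * c * t + 3 * d * t ^ 2 + 4 * e * t ^ 3) t := by
      have := ((((hasDerivAt_const t a).add ((hasDerivAt_id t).const_mul b)).add
        ((hasDerivAt_pow 2 t).const_mul c)).add ((hasDerivAt_pow 3 t).const_mul d)).add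
        ((hasDerivAt_pow 4 t).const_mul e)
      convert! this using 1
      push_cast; ring
    have h2 : HasDerivAt (fun t : ℝ => Real.exp (0 * t + v * t ^ 2 / 2))
        (Real.exp (0 * t + v * t ^ 2 / 2) * (v * t)) t := by
      apply HasDerivAt.exp
      have := ((hasDerivAt_id t).const_mul (0:ℝ)).add (((hasDerivAt_pow 2 t).const_mul (v:ℝ)).div_const 2)
      convert! this using 1
      push_cast; ring
    rw [(h1.fun_mul h2).deriv]; ring
  have e4 : iteratedDeriv 4 (fun t : ℝ => Real.exp (0 * t + v * t ^ 2 / 2)) 0 = 3 * (v : ℝ) ^ 2 := by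
    rw [iteratedDeriv_eq_iterate]
    have s0 : (fun t : ℝ => Real.exp (0 * t + v * t ^ 2 / 2)) = (fun t : ℝ => (1 + 0 * t + 0 * t ^ 2 + 0 * t ^ 3 + 0 * t ^ 4) * Real.exp (0 * t + v * t ^ 2 / 2)) := by
      ext t; ring
    have s1 := key 1 0 0 0 0
    have s2 := key 0 v 0 0 0
    have s3 := key v 0 (v ^ 2) 0 0
    have s4 := key 0 (3 * v ^ 2) 0 (v ^ 3) 0
    simp only [Function.iterate_succ, Function.iterate_zero, Function.comp, id]
    rw [s0, s1]
    have c1 : (fun t : ℝ => ((0:ℝ) + 2 * 0 * t + 3 * 0 * t ^ 2 + 4 * 0 * t ^ 3 + (1 + 0 * t + 0 * t ^ 2 + 0 * t ^ 3 + 0 * t ^ 4) * (v * t)) * Real.exp (0 * t + v * t ^ 2 / 2)) = (fun t : ℝ => (0 + v * t + 0 * t ^ 2 + 0 * t ^ 3 + 0 * t ^ 4) * Real.exp (0 * t + v * t ^ 2 / 2)) := by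
      ext t; ring
    rw [c1, s2]
    have c2 : (fun t : ℝ => ((v:ℝ) + 2 * 0 * t + 3 * 0 * t ^ 2 + 4 * 0 * t ^ 3 + (0 + v * t + 0 * t ^ 2 + 0 * t ^ 3 + 0 * t ^ 4) * (v * t)) * Real.exp (0 * t + v * t ^ 2 / 2)) = (fun t : ℝ => (v + 0 * t + v ^ 2 * t ^ 2 + 0 * t ^ 3 + 0 * t ^ 4) * Real.exp (0 * t + v * t ^ 2 / 2)) := by
      ext t; ring
    rw [c2, s3]
    have c3 : (fun t : ℝ => ((0:ℝ) + 2 * v ^ 2 * t + 3 * 0 * t ^ 2 + 4 * 0 * t ^ 3 + (v + 0 * t + v ^ 2 * t ^ 2 + 0 * t ^ 3 + 0 * t ^ 4) * (v * t)) * Real.exp (0 * t + v * t ^ 2 / 2)) = (fun t : ℝ => (0 + (3 * v ^ 2) * t + 0 * t ^ 2 + v ^ 3 * t ^ 3 + 0 * t ^ 4) * Real.exp (0 * t + v * t ^ 2 / 2)) := by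
      ext t; ring
    rw [c3, s4]
    simp
  rw [e4] at h
  rw [h]; simp

noncomputable def Lin {ι : Type*} [Fintype ι] (t : ι → ℝ) (θ : ι → ℝ) : ℝ := ∑ p, t p * θ p

section
variable {ι : Type*} [Fintype ι]

instance prob_stdG : IsProbabilityMeasure (_root_.stdGaussian ι) := by
  unfold _root_.stdGaussian; infer_instance

lemma indep_coord : iIndepFun (fun (i : ι) (θ : ι → ℝ) => θ i) (_root_.stdGaussian ι) := by
  unfold _root_.stdGaussian
  exact iIndepFun_pi (X := fun _ => id) (fun _ => aemeasurable_id)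

@[fun_prop]
lemma Lin_meas (t : ι → ℝ) : Measurable (Lin t) := by unfold Lin; fun_prop

lemma memLp_coord (i : ι) (p : ENNReal) (hp : p ≠ ⊤) :
    MemLp (fun θ : ι → ℝ => θ i) p (_root_.stdGaussian ι) := by
  unfold _root_.stdGaussian
  exact (memLp_id_gaussianReal' p hp).comp_measurePreserving (measurePreserving_eval _ i)

lemma Lin_memLp (t : ι → ℝ) (p : ENNReal) (hp : p ≠ ⊤) :
    MemLp (Lin t) p (_root_.stdGaussian ι) :=
  memLp_finsetSum _ fun i _ => (memLp_coord i p hp).const_mul _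

lemma Lin_var (t : ι → ℝ) : Var[Lin t; _root_.stdGaussian ι] = ∑ p, t p ^ 2 := by
  have : Lin t = ∑ i, fun θ : ι → ℝ => (fun y => t i * y) (θ i) := by
    ext θ; simp [Lin]
  rw [this]
  unfold _root_.stdGaussian
  rw [variance_sum_pi]
  · refine Finset.sum_congr rfl fun i _ => ?_
    rw [variance_const_mul, variance_fun_id_gaussianReal]; simp
  · intro i
    exact (memLp_id_gaussianReal' 2 (by simp)).const_mul _

lemma Lin_mean (t : ι → ℝ) : ∫ θ, Lin t θ ∂(_root_.stdGaussian ι) = 0 := by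
  unfold Lin
  rw [integral_finsetSum]
  · refine Finset.sum_eq_zero fun i _ => ?_
    rw [integral_const_mul]
    have h := integral_comp_eval (μ := fun _ : ι => gaussianReal 0 1) (i := i)
      (f := fun y : ℝ => y) (by fun_prop)
    unfold _root_.stdGaussian
    rw [h]
    simp
  · intro i _
    exact ((memLp_coord i 1 (by simp)).integrable le_rfl).const_mul _

lemma Lin_law (t : ι → ℝ) :
    (_root_.stdGaussian ι).map (Lin t) = gaussianReal 0 (∑ p, t p ^ 2).toNNReal := by
  have hg : HasGaussianLaw (Lin t) (_root_.stdGaussian ι) := by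
    have h1 : HasGaussianLaw (fun (θ : ι → ℝ) (i : ι) => θ i) (_root_.stdGaussian ι) := by
      refine iIndepFun.hasGaussianLaw (fun i => ⟨?_⟩) indep_coord
      unfold _root_.stdGaussian
      have := (measurePreserving_eval (fun _ : ι => gaussianReal 0 1) i).map_eq
      change IsGaussian (Measure.map (Function.eval i) (Measure.pi fun _ : ι => gaussianReal 0 1))
      rw [this]; infer_instance
    have h2 := h1.map_fun (∑ i, t i • ContinuousLinearMap.proj (R := ℝ) (φ := fun _ : ι => ℝ) i)
    convert! h2 using 1
    ext θ; simp [Lin]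
  rw [hg.map_eq_gaussianReal, Lin_var, Lin_mean]

lemma Lin_m2 (t : ι → ℝ) : ∫ θ, Lin t θ ^ 2 ∂(_root_.stdGaussian ι) = ∑ p, t p ^ 2 := by
  have := integral_map (μ := _root_.stdGaussian ι) (φ := Lin t) (f := fun y : ℝ => y ^ 2)
    (by fun_prop) (by fun_prop)
  rw [← this, Lin_law, gm2, Real.coe_toNNReal _ (Finset.sum_nonneg fun i _ => sq_nonneg _)]

lemma Lin_m4 (t : ι → ℝ) : ∫ θ, Lin t θ ^ 4 ∂(_root_.stdGaussian ι) = 3 * (∑ p, t p ^ 2) ^ 2 := by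
  have := integral_map (μ := _root_.stdGaussian ι) (φ := Lin t) (f := fun y : ℝ => y ^ 4)
    (by fun_prop) (by fun_prop)
  rw [← this, Lin_law, gm4, Real.coe_toNNReal _ (Finset.sum_nonneg fun i _ => sq_nonneg _)]

lemma Lin_int4 (t : ι → ℝ) (k : ℕ) (hk : k ≠ 0) : Integrable (fun θ => Lin t θ ^ k) (_root_.stdGaussian ι) := by
  have := (Lin_memLp t k (by simp)).integrable_norm_pow hk
  refine (integrable_norm_iff ?_).1 ?_
  · exact ((Lin_meas t).pow_const k).aestronglyMeasurable
  · simpa using this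

lemma Lin_add (s t : ι → ℝ) (θ : ι → ℝ) : Lin (s + t) θ = Lin s θ + Lin t θ := by
  simp [Lin, add_mul, Finset.sum_add_distrib]

lemma Lin_sub (s t : ι → ℝ) (θ : ι → ℝ) : Lin (s - t) θ = Lin s θ - Lin t θ := by
  simp [Lin, sub_mul, Finset.sum_sub_distrib]

lemma sum_add_sq (s t : ι → ℝ) : ∑ p, (s + t) p ^ 2 = ∑ p, s p ^ 2 + 2 * ∑ p, s p * t p + ∑ p, t p ^ 2 := by
  rw [Finset.mul_sum, ← Finset.sum_add_distrib, ← Finset.sum_add_distrib]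
  exact Finset.sum_congr rfl fun i _ => by simp; ring

lemma sum_sub_sq (s t : ι → ℝ) : ∑ p, (s - t) p ^ 2 = ∑ p, s p ^ 2 - 2 * ∑ p, s p * t p + ∑ p, t p ^ 2 := by
  rw [Finset.mul_sum, ← Finset.sum_sub_distrib, ← Finset.sum_add_distrib]
  exact Finset.sum_congr rfl fun i _ => by simp; ring

lemma prod_memLp (s t : ι → ℝ) : MemLp (fun θ => Lin s θ * Lin t θ) 2 (_root_.stdGaussian ι) := by
  have : ENNReal.HolderTriple 4 4 2 := ⟨by
    rw [← two_mul, show (4 : ENNReal) = 2 * 2 by norm_num, ENNReal.mul_inv (by simp) (by simp),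
      ← mul_assoc, ENNReal.mul_inv_cancel (by simp) (by simp), one_mul]⟩
  exact (Lin_memLp t 4 (by simp)).mul (r := 2) (Lin_memLp s 4 (by simp))

lemma var_prod (s t : ι → ℝ) : Var[fun θ => Lin s θ * Lin t θ; _root_.stdGaussian ι] =
    (∑ p, s p ^ 2) * (∑ p, t p ^ 2) + (∑ p, s p * t p) ^ 2 := by
  rw [variance_eq_sub (prod_memLp s t)]
  have e1 : ∫ θ, Lin s θ * Lin t θ ∂(_root_.stdGaussian ι) = ∑ p, s p * t p := by
    have : (fun θ => Lin s θ * Lin t θ) = fun θ => (4:ℝ)⁻¹ * (Lin (s + t) θ ^ 2 - Lin (s - t) θ ^ 2) := by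
      ext θ; rw [Lin_add, Lin_sub]; ring
    rw [this, integral_const_mul, integral_sub (Lin_int4 _ 2 (by simp)) (Lin_int4 _ 2 (by simp)),
      Lin_m2, Lin_m2, sum_add_sq, sum_sub_sq]
    ring
  have e2 : ∫ θ, (Lin s θ * Lin t θ) ^ 2 ∂(_root_.stdGaussian ι) =
      (∑ p, s p ^ 2) * (∑ p, t p ^ 2) + 2 * (∑ p, s p * t p) ^ 2 := by
    have : (fun θ => (Lin s θ * Lin t θ) ^ 2) = fun θ => (12:ℝ)⁻¹ * ((Lin (s + t) θ ^ 4 + Lin (s - t) θ ^ 4) - (2 * Lin s θ ^ 4 + 2 * Lin t θ ^ 4)) := by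
      ext θ; rw [Lin_add, Lin_sub]; ring
    have i4 := fun r : ι → ℝ => Lin_int4 r 4 (by simp)
    rw [this, integral_const_mul, integral_sub (by exact (i4 _).add (i4 _)) (by exact ((i4 _).const_mul _).add ((i4 _).const_mul _)),
      integral_add (i4 _) (i4 _), integral_add ((i4 _).const_mul _) ((i4 _).const_mul _),
      integral_const_mul, integral_const_mul,
      Lin_m4, Lin_m4, Lin_m4, Lin_m4, sum_add_sq, sum_sub_sq]
    ring
  have e2' : ∫ θ, ((fun θ => Lin s θ * Lin t θ) ^ 2) θ ∂(_root_.stdGaussian ι) = _ := e2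
  rw [e2', e1]; ring

lemma Lin_restrict (S : Finset ι) (s : ι → ℝ) (h : ∀ p, p ∉ S → s p = 0) (θ : ι → ℝ) :
    Lin s θ = ∑ p : S, s p * θ p := by
  unfold Lin
  rw [Finset.sum_coe_sort S (fun p => s p * θ p)]
  symm
  apply Finset.sum_subset (Finset.subset_univ _)
  intro p _ hp
  simp [h p hp]

lemma indep_prod (s t s' t' : ι → ℝ) (h : ∀ p, (s p ≠ 0 ∨ t p ≠ 0) → (s' p = 0 ∧ t' p = 0)) :
    IndepFun (fun θ => Lin s θ * Lin t θ) (fun θ => Lin s' θ * Lin t' θ) (_root_.stdGaussian ι) := by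
  classical
  let S : Finset ι := Finset.univ.filter fun p => s p ≠ 0 ∨ t p ≠ 0
  let T : Finset ι := Sᶜ
  have hi := iIndepFun.indepFun_finset S T disjoint_compl_right (indep_coord (ι := ι)) (by fun_prop)
  have hc := hi.comp (φ := fun y : S → ℝ => (∑ p : S, s p * y p) * (∑ p : S, t p * y p))
    (ψ := fun y : T → ℝ => (∑ p : T, s' p * y p) * (∑ p : T, t' p * y p)) (by fun_prop) (by fun_prop)
  have hS : ∀ p, p ∉ S → s p = 0 ∧ t p = 0 := by
    intro p hp
    simpa [S] using hp
  have hT : ∀ p, p ∉ T → s' p = 0 ∧ t' p = 0 := by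
    intro p hp
    apply h
    simp only [T, S, Finset.mem_compl, Finset.mem_filter, Finset.mem_univ, true_and, not_not] at hp
    exact hp
  convert! hc using 1
  · ext θ
    simp only [Function.comp]
    rw [Lin_restrict S s (fun p hp => (hS p hp).1), Lin_restrict S t (fun p hp => (hS p hp).2)]
  · ext θ
    simp only [Function.comp]
    rw [Lin_restrict T s' (fun p hp => (hT p hp).1), Lin_restrict T t' (fun p hp => (hT p hp).2)]

end

/-- coefficient vectors -/
noncomputable def cf (n D : ℕ) (c : ℝ) (x : Fin D → ℝ) :
    Fin n ⊕ Fin n → (Fin n ⊕ Fin n × Fin D) → ℝ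
  | Sum.inl i, Sum.inl j => if j = i then c else 0
  | Sum.inl _, Sum.inr _ => 0
  | Sum.inr _, Sum.inl _ => 0
  | Sum.inr i, Sum.inr (j, α) => if j = i then x α else 0

lemma fd (n D : ℕ) (θ : (Fin n ⊕ Fin n × Fin D) → ℝ) (x : Fin D → ℝ) (v : (Fin n ⊕ Fin n × Fin D) → ℝ) :
    fderiv ℝ (fun ψ => net1 n D ψ x) θ v = ((n : ℝ) ^ (-(1 / 2 : ℝ))) *
    ∑ i : Fin n, (θ (Sum.inl i) * ∑ α : Fin D, v (Sum.inr (i, α)) * x α +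
      v (Sum.inl i) * ∑ α : Fin D, θ (Sum.inr (i, α)) * x α) := by
  have hp : ∀ q : Fin n ⊕ Fin n × Fin D, HasFDerivAt (fun ψ : (Fin n ⊕ Fin n × Fin D) → ℝ => ψ q)
      (ContinuousLinearMap.proj (R := ℝ) (φ := fun _ => ℝ) q) θ := fun q => hasFDerivAt_apply q θ
  have := HasFDerivAt.const_mul (HasFDerivAt.fun_sum (u := Finset.univ) fun i _ => (hp (Sum.inl i)).fun_mul
    (HasFDerivAt.fun_sum (u := Finset.univ) fun α _ => (hp (Sum.inr (i, α))).mul_const (x α)))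
    ((n : ℝ) ^ (-(1 / 2 : ℝ)))
  unfold net1
  rw [this.fderiv]
  simp [mul_comm]

lemma ntk_eq (n D : ℕ) (θ : (Fin n ⊕ Fin n × Fin D) → ℝ) (x x' : Fin D → ℝ) :
    ntk1 n D θ x x' = (n : ℝ)⁻¹ * ∑ k : Fin n ⊕ Fin n,
      Lin (cf n D (∑ α, x α * x' α) x k) θ * Lin (cf n D 1 x' k) θ := by
  have hn : ((n : ℝ) ^ (-(1 / 2 : ℝ))) * ((n : ℝ) ^ (-(1 / 2 : ℝ))) = (n : ℝ)⁻¹ := by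
    rcases Nat.eq_zero_or_pos n with rfl | h
    · norm_num
    · rw [← Real.rpow_add (by positivity), ← Real.rpow_neg_one]; norm_num
  unfold ntk1
  simp only [fd]
  simp only [mul_mul_mul_comm, hn, ← Finset.mul_sum]
  congr 1
  rw [Fintype.sum_sum_type, Fintype.sum_sum_type, add_comm]
  congr 1
  · rw [Fintype.sum_prod_type]
    refine Finset.sum_congr rfl fun i _ => ?_
    simp [Lin, cf, Fintype.sum_sum_type, Pi.single_apply, Fintype.sum_prod_type, ite_and,
      Finset.sum_mul, Finset.mul_sum]
    exact Finset.sum_congr rfl fun α _ => by ring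
  · refine Finset.sum_congr rfl fun i _ => ?_
    simp [Lin, cf, Fintype.sum_sum_type, Pi.single_apply, Fintype.sum_prod_type, mul_comm]

lemma main_var (D : ℕ) (x x' : Fin D → ℝ) (n : ℕ) (hn : 0 < n) :
      variance (fun θ => ntk1 n D θ x x') (_root_.stdGaussian (Fin n ⊕ Fin n × Fin D)) =
        ((∑ α : Fin D, x α ^ 2) * (∑ α : Fin D, x' α ^ 2) +
            3 * (∑ α : Fin D, x α * x' α) ^ 2) / n := by
  simp only [ntk_eq]
  rw [variance_const_mul]
  have := IndepFun.variance_sum (μ := _root_.stdGaussian (Fin n ⊕ Fin n × Fin D)) (s := Finset.univ)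
    (X := fun k θ => Lin (cf n D (∑ α, x α * x' α) x k) θ * Lin (cf n D 1 x' k) θ)
    (fun k _ => prod_memLp _ _) (by
      intro k _ l _ hkl
      apply indep_prod
      rintro (j | ⟨j, α⟩) <;> rcases k with k | k <;> rcases l with l | l <;> simp [cf] at hkl ⊢
      · rintro (⟨rfl, _⟩ | rfl) <;> simp [hkl]
      · rintro (⟨rfl, _⟩ | ⟨rfl, _⟩) <;> simp [hkl])
  have e : (fun θ => ∑ k, Lin (cf n D (∑ α, x α * x' α) x k) θ * Lin (cf n D 1 x' k) θ) =
    ∑ k, fun θ => Lin (cf n D (∑ α, x α * x' α) x k) θ * Lin (cf n D 1 x' k) θ := by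
    ext θ; simp
  rw [e, this]
  simp only [var_prod, Fintype.sum_sum_type]
  simp [cf, Fintype.sum_sum_type, Fintype.sum_prod_type, ite_pow]
  have hn' : (n : ℝ) ≠ 0 := by positivity
  field_simp
  ring

/-- The variance over the standard Gaussian initialization of the NTK of the one-hidden-layer
linear network is exactly `(‖x‖²‖x'‖² + 3⟨x,x'⟩²)/n`; in particular it is `O(n⁻¹)` as
`n → ∞`. -/
theorem ntk_variance_one_hidden_layer (D : ℕ) (x x' : Fin D → ℝ) :
    (∀ n : ℕ, 0 < n →
      variance (fun θ => ntk1 n D θ x x') (stdGaussian (Fin n ⊕ Fin n × Fin D)) =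
        ((∑ α : Fin D, x α ^ 2) * (∑ α : Fin D, x' α ^ 2) +
            3 * (∑ α : Fin D, x α * x' α) ^ 2) / n) ∧
    (fun n : ℕ => variance (fun θ => ntk1 n D θ x x') (stdGaussian (Fin n ⊕ Fin n × Fin D)))
      =O[atTop] (fun n : ℕ => (n : ℝ)⁻¹) := by
  refine ⟨main_var D x x', ?_⟩
  refine ((isBigO_refl (fun n : ℕ => (n : ℝ)⁻¹) atTop).const_mul_left ((∑ α : Fin D, x α ^ 2) * (∑ α : Fin D, x' α ^ 2) +
            3 * (∑ α : Fin D, x α * x' α) ^ 2)).congr' ?_ EventuallyEq.rfl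
  filter_upwards [eventually_gt_atTop 0] with n hn
  rw [main_var D x x' n hn, div_eq_mul_inv]
end

section
/- Let P be a positive integer, let D be a finite set of training pairs (x, y) with y ∈ ℝ, and let f : ℝ^P × X → ℝ be smooth in θ for every input. Define recursively O_1(x)(θ) = f(θ, x) and, for s ≥ 2, O_s(x_1,…,x_s)(θ) = ⟨∇_θ O_{s−1}(x_1,…,x_{s−1})(θ), ∇_θ f(θ, x_s)⟩. Suppose θ : ℝ → ℝ^P satisfies gradient flow θ'(t) = −∇L(θ(t)) for the MSE loss L(θ) = (1/2) Σ_{(x',y') ∈ D} (f(θ,x') − y')². Then for every s ≥ 1, every inputs x_1,…,x_s, and every time t, d/dt [O_s(x_1,…,x_s)(θ(t))] = − Σ_{(x',y') ∈ D} O_{s+1}(x_1,…,x_s, x')(θ(t)) · (f(θ(t), x') − y'). (For s = 2, O_2 is the Neural Tangent Kernel.) -/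
open scoped RealInnerProductSpace

/-- The tower of operators `O_s`: `Otower f 0 = O_1 = f` and
`O_{s+1}(x_1,…,x_{s+1})(θ) = ⟨∇_θ O_s(x_1,…,x_s)(θ), ∇_θ f(θ, x_{s+1})⟩`.
(`Otower f s` is the operator `O_{s+1}` of the paper, taking `s+1` inputs.) -/
noncomputable def Otower {P : ℕ} {X : Type*} (f : EuclideanSpace ℝ (Fin P) → X → ℝ) :
    (s : ℕ) → (Fin (s + 1) → X) → EuclideanSpace ℝ (Fin P) → ℝ
  | 0, xs, θ => f θ (xs 0)
  | s + 1, xs, θ =>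
      ⟪gradient (Otower f s fun i => xs i.castSucc) θ,
        gradient (fun w => f w (xs (Fin.last (s + 1)))) θ⟫

theorem Otower_contDiff {P : ℕ} {X : Type*} (f : EuclideanSpace ℝ (Fin P) → X → ℝ)
    (hf : ∀ x : X, ContDiff ℝ (⊤ : ℕ∞) fun θ => f θ x) (s : ℕ) :
    ∀ xs : Fin (s + 1) → X, ContDiff ℝ (⊤ : ℕ∞) (Otower f s xs) := by
  have hg : ∀ g : EuclideanSpace ℝ (Fin P) → ℝ, ContDiff ℝ (⊤ : ℕ∞) g →
      ContDiff ℝ (⊤ : ℕ∞) (fun w => gradient g w) := by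
    intro g hg
    have h1 : ContDiff ℝ (⊤ : ℕ∞) (fderiv ℝ g) := hg.fderiv_right (by simp)
    exact (InnerProductSpace.toDual ℝ (EuclideanSpace ℝ (Fin P))).symm.contDiff.comp h1
  induction s with
  | zero => intro xs; exact hf (xs 0)
  | succ s ih =>
    intro xs
    exact (hg _ (ih _)).inner ℝ (hg _ (hf _))

/-- Under gradient flow for the MSE loss `L(θ) = (1/2) Σ_{(x',y') ∈ D} (f(θ,x') − y')²`,
the operators `O_s` satisfy, for all `s ≥ 1`, inputs `x_1,…,x_s` and times `t`,
`d/dt O_s(x_1,…,x_s)(θ(t)) = − Σ_{(x',y') ∈ D} O_{s+1}(x_1,…,x_s,x')(θ(t)) (f(θ(t),x') − y')`.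
(For `s = 2`, `O_2` is the Neural Tangent Kernel.) -/
theorem operator_tower_evolution {P : ℕ} (hP : 0 < P) {X : Type*}
    (D : Finset (X × ℝ))
    (f : EuclideanSpace ℝ (Fin P) → X → ℝ)
    (hf : ∀ x : X, ContDiff ℝ (⊤ : ℕ∞) fun θ => f θ x)
    (θ : ℝ → EuclideanSpace ℝ (Fin P))
    (hθ : Differentiable ℝ θ)
    (hflow : ∀ t : ℝ,
      deriv θ t =
        -gradient (fun w => (1 / 2 : ℝ) * ∑ p ∈ D, (f w p.1 - p.2) ^ 2) (θ t)) :
    ∀ (s : ℕ) (xs : Fin (s + 1) → X) (t : ℝ),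
      deriv (fun u => Otower f s xs (θ u)) t =
        -∑ p ∈ D, Otower f (s + 1) (Fin.snoc xs p.1) (θ t) * (f (θ t) p.1 - p.2) := by
  intro s xs t
  have hO : DifferentiableAt ℝ (Otower f s xs) (θ t) :=
    (Otower_contDiff f hf s xs).differentiable (by simp) _
  have hfd : ∀ x, DifferentiableAt ℝ (fun w => f w x) (θ t) := fun x =>
    (hf x).differentiable (by simp) _
  have h1 : HasDerivAt (fun u => Otower f s xs (θ u))
      (fderiv ℝ (Otower f s xs) (θ t) (deriv θ t)) t :=
    hO.hasFDerivAt.comp_hasDerivAt t (hθ t).hasDerivAt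
  have hL : HasFDerivAt (fun w => (1 / 2 : ℝ) * ∑ p ∈ D, (f w p.1 - p.2) ^ 2)
      (∑ p ∈ D, (f (θ t) p.1 - p.2) • fderiv ℝ (fun w => f w p.1) (θ t)) (θ t) := by
    have h2 : HasFDerivAt (fun w => ∑ p ∈ D, (f w p.1 - p.2) ^ 2)
        (∑ p ∈ D, (2 * (f (θ t) p.1 - p.2)) • fderiv ℝ (fun w => f w p.1) (θ t)) (θ t) := by
      refine HasFDerivAt.fun_sum fun p _ => ?_
      simpa using ((hfd p.1).hasFDerivAt.sub_const p.2).pow 2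
    refine (h2.const_mul (1 / 2 : ℝ)).congr_fderiv ?_
    rw [Finset.smul_sum]
    refine Finset.sum_congr rfl fun p _ => ?_
    rw [smul_smul]
    congr 1
    ring
  have hgrad : gradient (fun w => (1 / 2 : ℝ) * ∑ p ∈ D, (f w p.1 - p.2) ^ 2) (θ t)
      = ∑ p ∈ D, (f (θ t) p.1 - p.2) • gradient (fun w => f w p.1) (θ t) := by
    simp only [gradient]
    rw [hL.fderiv, map_sum]
    simp
  rw [h1.deriv, hflow t, hgrad, map_neg, map_sum]
  congr 1
  refine Finset.sum_congr rfl fun p _ => ?_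
  have h3 : Otower f (s + 1) (Fin.snoc xs p.1) (θ t)
      = ⟪gradient (Otower f s xs) (θ t), gradient (fun w => f w p.1) (θ t)⟫ := by
    simp [Otower]
  rw [h3, map_smul, smul_eq_mul, mul_comm]
  congr 1
  simp [gradient]
end

section
/- Fix a learning rate η > 0, a finite training set D = {(x_a, y_a)} with x_a ∈ ℝ^{D_in}, y_a ∈ ℝ, and test inputs x, x' ∈ ℝ^{D_in}. For each width n, consider the one-hidden-layer linear network f_θ(x) = n^{-1/2} Σ_{i=1}^n V_i (Σ_α U_{iα} x_α) with independent standard Gaussian initialization, the MSE loss L(θ) = (1/2) Σ_a (f_θ(x_a) − y_a)², the single gradient descent update θ' = θ − η ∇L(θ), and the Neural Tangent Kernel Θ_θ(x,x') = Σ_μ (∂f_θ(x)/∂θ^μ)(∂f_θ(x')/∂θ^μ). Then the expected change of the kernel after one gradient descent step satisfies E_θ[ Θ_{θ'}(x,x') − Θ_θ(x,x') ] = O(n^{−1}) as n → ∞. -/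
open MeasureTheory ProbabilityTheory Asymptotics Filter

/-- The MSE loss `L(θ) = (1/2) Σ_{(x_a,y_a) ∈ D} (f_θ(x_a) − y_a)²` over a finite training
set. -/
noncomputable def mseLoss (n D : ℕ) (Dtr : Finset ((Fin D → ℝ) × ℝ))
    (θ : (Fin n ⊕ Fin n × Fin D) → ℝ) : ℝ :=
  (1 / 2 : ℝ) * ∑ p ∈ Dtr, (net1 n D θ p.1 - p.2) ^ 2

/-- A single gradient descent step `θ' = θ − η ∇L(θ)`, written componentwise as
`θ'^μ = θ^μ − η ∂L/∂θ^μ`. -/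
noncomputable def gdStep (n D : ℕ) (η : ℝ) (Dtr : Finset ((Fin D → ℝ) × ℝ))
    (θ : (Fin n ⊕ Fin n × Fin D) → ℝ) : (Fin n ⊕ Fin n × Fin D) → ℝ :=
  fun μ => θ μ - η * fderiv ℝ (mseLoss n D Dtr) θ (Pi.single μ 1)

theorem net1_hasFDeriv (n D : ℕ) (θ : (Fin n ⊕ Fin n × Fin D) → ℝ) (x : Fin D → ℝ) :
    ∃ L : ((Fin n ⊕ Fin n × Fin D) → ℝ) →L[ℝ] ℝ,
      HasFDerivAt (fun ψ => net1 n D ψ x) L θ ∧ ∀ v, L v = ((n : ℝ) ^ (-(1 / 2 : ℝ))) *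
        ∑ i : Fin n, (θ (Sum.inl i) * (∑ α : Fin D, v (Sum.inr (i, α)) * x α) +
          v (Sum.inl i) * ∑ α : Fin D, θ (Sum.inr (i, α)) * x α) := by
  have h1 : ∀ μ, HasFDerivAt (fun ψ : (Fin n ⊕ Fin n × Fin D) → ℝ => ψ μ)
      (ContinuousLinearMap.proj (R := ℝ) (φ := fun _ => ℝ) μ) θ := fun μ => hasFDerivAt_apply μ θ
  have h2 : ∀ i : Fin n, HasFDerivAt
      (fun ψ : (Fin n ⊕ Fin n × Fin D) → ℝ => ∑ α : Fin D, ψ (Sum.inr (i, α)) * x α) _ θ :=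
    fun i => HasFDerivAt.fun_sum (fun α _ => (h1 (Sum.inr (i, α))).mul_const (x α))
  have h3 := (HasFDerivAt.fun_sum (u := Finset.univ)
    (fun (i : Fin n) _ => (h1 (Sum.inl i)).mul (h2 i))).const_mul ((n : ℝ) ^ (-(1 / 2 : ℝ)))
  refine ⟨_, h3, fun v => ?_⟩
  simp [mul_comm]

theorem net1_fderiv (n D : ℕ) (θ v : (Fin n ⊕ Fin n × Fin D) → ℝ) (x : Fin D → ℝ) :
    fderiv ℝ (fun ψ => net1 n D ψ x) θ v = ((n : ℝ) ^ (-(1 / 2 : ℝ))) *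
        ∑ i : Fin n, (θ (Sum.inl i) * (∑ α : Fin D, v (Sum.inr (i, α)) * x α) +
          v (Sum.inl i) * ∑ α : Fin D, θ (Sum.inr (i, α)) * x α) := by
  obtain ⟨L, h, h'⟩ := net1_hasFDeriv n D θ x
  rw [h.fderiv, h']

theorem net1_fderiv_inl (n D : ℕ) (θ : (Fin n ⊕ Fin n × Fin D) → ℝ) (x : Fin D → ℝ) (i : Fin n) :
    fderiv ℝ (fun ψ => net1 n D ψ x) θ (Pi.single (Sum.inl i) 1) = ((n : ℝ) ^ (-(1 / 2 : ℝ))) *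
        ∑ α : Fin D, θ (Sum.inr (i, α)) * x α := by
  rw [net1_fderiv]
  simp [Pi.single_apply]

theorem net1_fderiv_inr (n D : ℕ) (θ : (Fin n ⊕ Fin n × Fin D) → ℝ) (x : Fin D → ℝ) (i : Fin n)
    (α : Fin D) :
    fderiv ℝ (fun ψ => net1 n D ψ x) θ (Pi.single (Sum.inr (i, α)) 1) =
      ((n : ℝ) ^ (-(1 / 2 : ℝ))) * (θ (Sum.inl i) * x α) := by
  rw [net1_fderiv]
  congr 1
  rw [Finset.sum_eq_single i]
  · simp [Pi.single_apply]
  · intro j _ hj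
    simp [hj]
  · simp

theorem loss_fderiv (n D : ℕ) (Dtr : Finset ((Fin D → ℝ) × ℝ))
    (θ v : (Fin n ⊕ Fin n × Fin D) → ℝ) :
    fderiv ℝ (mseLoss n D Dtr) θ v = ∑ p ∈ Dtr, (net1 n D θ p.1 - p.2) *
      fderiv ℝ (fun ψ => net1 n D ψ p.1) θ v := by
  have h : ∀ p ∈ Dtr, HasFDerivAt (fun ψ => (net1 n D ψ p.1 - p.2) ^ 2) _ θ := fun p _ =>
    (((net1_hasFDeriv n D θ p.1).choose_spec.1.differentiableAt.hasFDerivAt).sub_const p.2).pow 2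
  have h3 : HasFDerivAt (mseLoss n D Dtr) _ θ := (HasFDerivAt.fun_sum h).const_mul (1 / 2 : ℝ)
  rw [h3.fderiv]
  simp [Finset.mul_sum]
  refine Finset.sum_congr rfl fun p _ => ?_
  ring

/-- residual-weighted input -/
noncomputable def ww (n D : ℕ) (Dtr : Finset ((Fin D → ℝ) × ℝ))
    (θ : (Fin n ⊕ Fin n × Fin D) → ℝ) (β : Fin D) : ℝ :=
  ∑ p ∈ Dtr, (net1 n D θ p.1 - p.2) * p.1 β

theorem gd_inl (n D : ℕ) (η : ℝ) (Dtr : Finset ((Fin D → ℝ) × ℝ))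
    (θ : (Fin n ⊕ Fin n × Fin D) → ℝ) (i : Fin n) :
    gdStep n D η Dtr θ (Sum.inl i) = θ (Sum.inl i) - η * ((n : ℝ) ^ (-(1 / 2 : ℝ))) *
      ∑ α, θ (Sum.inr (i, α)) * ww n D Dtr θ α := by
  unfold gdStep
  rw [loss_fderiv]
  simp only [net1_fderiv_inl, ww, Finset.mul_sum]
  rw [Finset.sum_comm]
  congr 1
  refine Finset.sum_congr rfl fun p _ => Finset.sum_congr rfl fun p _ => ?_
  ring

theorem gd_inr (n D : ℕ) (η : ℝ) (Dtr : Finset ((Fin D → ℝ) × ℝ))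
    (θ : (Fin n ⊕ Fin n × Fin D) → ℝ) (i : Fin n) (α : Fin D) :
    gdStep n D η Dtr θ (Sum.inr (i, α)) = θ (Sum.inr (i, α)) - η * ((n : ℝ) ^ (-(1 / 2 : ℝ))) *
      θ (Sum.inl i) * ww n D Dtr θ α := by
  unfold gdStep
  rw [loss_fderiv]
  simp only [net1_fderiv_inr, ww, Finset.mul_sum]
  congr 1
  refine Finset.sum_congr rfl fun p _ => ?_
  ring

theorem csq (n : ℕ) : ((n : ℝ) ^ (-(1 / 2 : ℝ))) ^ 2 = (n : ℝ)⁻¹ := by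
  rw [← Real.rpow_natCast, ← Real.rpow_mul (by positivity)]
  norm_num
  exact Real.rpow_neg_one _

theorem ntk1_eq (n D : ℕ) (θ : (Fin n ⊕ Fin n × Fin D) → ℝ) (x x' : Fin D → ℝ) :
    ntk1 n D θ x x' = ((n : ℝ) ^ (-(1 / 2 : ℝ))) ^ 2 * ∑ i : Fin n,
      ((∑ α, θ (Sum.inr (i, α)) * x α) * (∑ α, θ (Sum.inr (i, α)) * x' α) +
        θ (Sum.inl i) ^ 2 * ∑ α, x α * x' α) := by
  unfold ntk1
  rw [Fintype.sum_sum_type, Fintype.sum_prod_type, ← Finset.sum_add_distrib, Finset.mul_sum]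
  refine Finset.sum_congr rfl fun i _ => ?_
  simp only [net1_fderiv_inl, net1_fderiv_inr]
  rw [mul_add]
  congr 1
  · ring
  · simp only [Finset.mul_sum]
    refine Finset.sum_congr rfl fun α _ => ?_
    ring

/-- the order parameters -/
noncomputable def FF (n D : ℕ) (θ : (Fin n ⊕ Fin n × Fin D) → ℝ) (α : Fin D) : ℝ :=
  ((n : ℝ) ^ (-(1 / 2 : ℝ))) * ∑ i : Fin n, θ (Sum.inl i) * θ (Sum.inr (i, α))

theorem net1_eq (n D : ℕ) (θ : (Fin n ⊕ Fin n × Fin D) → ℝ) (x : Fin D → ℝ) :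
    net1 n D θ x = ∑ α, FF n D θ α * x α := by
  unfold net1 FF
  simp only [Finset.mul_sum, Finset.sum_mul]
  rw [Finset.sum_comm]
  refine Finset.sum_congr rfl fun p _ => Finset.sum_congr rfl fun p _ => ?_
  ring

theorem alg_aux (n : ℕ) (c η a b d : ℝ) (V p q r : Fin n → ℝ) :
    ∑ i, ((p i - η * c * V i * a) * (q i - η * c * V i * b) + (V i - η * c * r i) ^ 2 * d -
      (p i * q i + V i ^ 2 * d)) =
    -η * (a * (c * ∑ i, V i * q i) + b * (c * ∑ i, V i * p i) + 2 * d * (c * ∑ i, V i * r i)) +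
      η ^ 2 * (a * b * (c ^ 2 * ∑ i, V i ^ 2) + d * (c ^ 2 * ∑ i, r i ^ 2)) := by
  simp only [Finset.mul_sum, ← Finset.sum_add_distrib]
  refine Finset.sum_congr rfl fun i _ => ?_
  ring

theorem change_eq (n D : ℕ) (η : ℝ) (Dtr : Finset ((Fin D → ℝ) × ℝ))
    (θ : (Fin n ⊕ Fin n × Fin D) → ℝ) (x x' : Fin D → ℝ) :
    ntk1 n D (gdStep n D η Dtr θ) x x' - ntk1 n D θ x x' =
     (n : ℝ)⁻¹ * (- η * ((∑ α, ww n D Dtr θ α * x α) * net1 n D θ x' +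
        (∑ α, ww n D Dtr θ α * x' α) * net1 n D θ x
        + 2 * (∑ α, x α * x' α) * net1 n D θ (ww n D Dtr θ))
      + η ^ 2 * ((∑ α, ww n D Dtr θ α * x α) * (∑ α, ww n D Dtr θ α * x' α) *
          ((n : ℝ)⁻¹ * ∑ i, θ (Sum.inl i) ^ 2)
        + (∑ α, x α * x' α) * ((n : ℝ)⁻¹ * ∑ i, (∑ α, θ (Sum.inr (i, α)) * ww n D Dtr θ α) ^ 2))) := by
  rw [ntk1_eq, ntk1_eq, ← mul_sub, ← Finset.sum_sub_distrib, csq]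
  congr 1
  simp only [gd_inl, gd_inr]
  have h : ∀ (i : Fin n) (z : Fin D → ℝ), ∑ α, (θ (Sum.inr (i, α)) - η * ((n : ℝ) ^ (-(1 / 2 : ℝ))) *
      θ (Sum.inl i) * ww n D Dtr θ α) * z α = (∑ α, θ (Sum.inr (i, α)) * z α)
       - η * ((n : ℝ) ^ (-(1 / 2 : ℝ))) * θ (Sum.inl i) * ∑ α, ww n D Dtr θ α * z α := by
    intro i z
    rw [Finset.mul_sum, ← Finset.sum_sub_distrib]
    refine Finset.sum_congr rfl fun p _ => ?_
    ring
  simp only [h, ← csq]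
  exact alg_aux n _ _ _ _ _ _ _ _ _

/-- mean squared parameter size -/
noncomputable def RR (n D : ℕ) (θ : (Fin n ⊕ Fin n × Fin D) → ℝ) : ℝ :=
  (n : ℝ)⁻¹ * ∑ μ, θ μ ^ 2

/-- squared size of the order parameters -/
noncomputable def Phi (n D : ℕ) (θ : (Fin n ⊕ Fin n × Fin D) → ℝ) : ℝ :=
  ∑ α, FF n D θ α ^ 2

theorem Phi_nonneg (n D : ℕ) (θ : (Fin n ⊕ Fin n × Fin D) → ℝ) : 0 ≤ Phi n D θ :=
  Finset.sum_nonneg fun _ _ => sq_nonneg _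

theorem RR_nonneg (n D : ℕ) (θ : (Fin n ⊕ Fin n × Fin D) → ℝ) : 0 ≤ RR n D θ :=
  mul_nonneg (by positivity) (Finset.sum_nonneg fun _ _ => sq_nonneg _)

theorem net1_sq_le (n D : ℕ) (θ : (Fin n ⊕ Fin n × Fin D) → ℝ) (z : Fin D → ℝ) :
    net1 n D θ z ^ 2 ≤ Phi n D θ * ∑ α, z α ^ 2 := by
  rw [net1_eq]
  exact Finset.sum_mul_sq_le_sq_mul_sq _ _ _

theorem res_le (n D : ℕ) (Dtr : Finset ((Fin D → ℝ) × ℝ)) (θ : (Fin n ⊕ Fin n × Fin D) → ℝ) :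
    ∑ p ∈ Dtr, (net1 n D θ p.1 - p.2) ^ 2 ≤
      (∑ p ∈ Dtr, (2 * ∑ α, p.1 α ^ 2 + 2 * p.2 ^ 2)) * (1 + Phi n D θ) := by
  rw [Finset.sum_mul]
  refine Finset.sum_le_sum fun p _ => ?_
  have h1 := net1_sq_le n D θ p.1
  have h2 : 0 ≤ ∑ α, p.1 α ^ 2 := Finset.sum_nonneg fun _ _ => sq_nonneg _
  have h3 := Phi_nonneg n D θ
  nlinarith [sq_nonneg (net1 n D θ p.1 + p.2), mul_nonneg (sq_nonneg p.2) h3]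

theorem wdot_le (D : ℕ) (Dtr : Finset ((Fin D → ℝ) × ℝ)) (z : Fin D → ℝ) :
    ∃ K, 0 ≤ K ∧ ∀ n θ, (∑ α, ww n D Dtr θ α * z α) ^ 2 ≤ K * (1 + Phi n D θ) := by
  refine ⟨(∑ p ∈ Dtr, (2 * ∑ α, p.1 α ^ 2 + 2 * p.2 ^ 2)) * ∑ p ∈ Dtr, (∑ α, p.1 α * z α) ^ 2,
    by positivity, fun n θ => ?_⟩
  have h : ∑ α, ww n D Dtr θ α * z α =
      ∑ p ∈ Dtr, (net1 n D θ p.1 - p.2) * ∑ α, p.1 α * z α := by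
    simp only [ww, Finset.mul_sum, Finset.sum_mul]
    rw [Finset.sum_comm]
    refine Finset.sum_congr rfl fun p _ => Finset.sum_congr rfl fun p _ => ?_
    ring
  rw [h]
  refine (Finset.sum_mul_sq_le_sq_mul_sq _ _ _).trans ?_
  refine (mul_le_mul_of_nonneg_right (res_le n D Dtr θ) (by positivity)).trans (le_of_eq ?_)
  ring

theorem wsq_le (D : ℕ) (Dtr : Finset ((Fin D → ℝ) × ℝ)) :
    ∃ K, 0 ≤ K ∧ ∀ n θ, ∑ α, ww n D Dtr θ α ^ 2 ≤ K * (1 + Phi n D θ) := by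
  refine ⟨(∑ p ∈ Dtr, (2 * ∑ α, p.1 α ^ 2 + 2 * p.2 ^ 2)) * ∑ α : Fin D, ∑ p ∈ Dtr, p.1 α ^ 2,
    by positivity, fun n θ => ?_⟩
  rw [mul_right_comm, Finset.mul_sum]
  refine Finset.sum_le_sum fun α _ => ?_
  refine (Finset.sum_mul_sq_le_sq_mul_sq _ _ _).trans ?_
  exact (mul_le_mul_of_nonneg_right (res_le n D Dtr θ) (by positivity))

theorem real_bound (η a b fx fx' fw d Q S Y R A B X X' C : ℝ) (hη : 0 ≤ η) (hY : 1 ≤ Y)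
    (hR : 0 ≤ R) (ha : a ^ 2 ≤ A * Y) (hb : b ^ 2 ≤ B * Y) (hx : fx ^ 2 ≤ X * Y)
    (hx' : fx' ^ 2 ≤ X' * Y) (hw : |fw| ≤ C * Y) (hQ0 : 0 ≤ Q) (hQ : Q ≤ R)
    (hS0 : 0 ≤ S) (hS : S ≤ C * (Y * R))
    (hA : 0 ≤ A) (hB : 0 ≤ B) (hX : 0 ≤ X) (hX' : 0 ≤ X') (hC : 0 ≤ C) :
    |-η * (a * fx' + b * fx + 2 * d * fw) + η ^ 2 * (a * b * Q + d * S)| ≤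
      (η * ((A + X') + (B + X) + 2 * |d| * C) + η ^ 2 * ((A + B) + |d| * C)) * ((1 + R) * Y) := by
  have key : ∀ u v P P' : ℝ, u ^ 2 ≤ P * Y → v ^ 2 ≤ P' * Y → |u * v| ≤ (P + P') * Y := by
    intro u v P P' hu hv
    rw [abs_le]
    constructor <;> nlinarith [sq_nonneg (u + v), sq_nonneg (u - v), sq_nonneg u, sq_nonneg v]
  have h1 := key a fx' A X' ha hx'
  have h2 := key b fx B X hb hx
  have h3 := key a b A B ha hb
  have h4 : |2 * d * fw| ≤ 2 * |d| * C * Y := by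
    rw [abs_mul, abs_mul, abs_two]
    have := mul_le_mul_of_nonneg_left hw (by positivity : 0 ≤ 2 * |d|)
    linarith
  have h5 : |a * b * Q| ≤ (A + B) * Y * R := by
    rw [abs_mul (a * b), abs_of_nonneg hQ0]
    exact mul_le_mul h3 hQ hQ0 (by positivity)
  have h6 : |d * S| ≤ |d| * (C * (Y * R)) := by
    rw [abs_mul, abs_of_nonneg hS0]
    exact mul_le_mul_of_nonneg_left hS (abs_nonneg _)
  have h7 : |a * fx' + b * fx + 2 * d * fw| ≤ ((A + X') + (B + X) + 2 * |d| * C) * Y := by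
    refine (abs_add_three _ _ _).trans ?_
    linarith
  have h8 : |a * b * Q + d * S| ≤ ((A + B) + |d| * C) * (Y * R) := by
    refine (abs_add_le _ _).trans ?_
    linarith
  refine (abs_add_le _ _).trans ?_
  rw [abs_mul, abs_mul, abs_neg, abs_of_nonneg hη, abs_of_nonneg (sq_nonneg η)]
  have h9 := mul_le_mul_of_nonneg_left h7 hη
  have h10 := mul_le_mul_of_nonneg_left h8 (sq_nonneg η)
  refine (add_le_add h9 h10).trans ?_
  have h11 : 0 ≤ η * ((A + X') + (B + X) + 2 * |d| * C) * (R * Y) := by positivity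
  have h12 : 0 ≤ η ^ 2 * ((A + B) + |d| * C) * Y := by positivity
  nlinarith

theorem change_le (D : ℕ) (η : ℝ) (hη : 0 < η) (Dtr : Finset ((Fin D → ℝ) × ℝ))
    (x x' : Fin D → ℝ) : ∃ K, 0 ≤ K ∧ ∀ n θ,
      |ntk1 n D (gdStep n D η Dtr θ) x x' - ntk1 n D θ x x'| ≤
        (n : ℝ)⁻¹ * (K * ((1 + RR n D θ) * (1 + Phi n D θ))) := by
  obtain ⟨A, hA, hA'⟩ := wdot_le D Dtr x
  obtain ⟨B, hB, hB'⟩ := wdot_le D Dtr x'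
  obtain ⟨W, hW, hW'⟩ := wsq_le D Dtr
  refine ⟨(η * ((A + ∑ α, x' α ^ 2) + (B + ∑ α, x α ^ 2) + 2 * |∑ α, x α * x' α| * (1 + W)) +
    η ^ 2 * ((A + B) + |∑ α, x α * x' α| * (1 + W))), by positivity, fun n θ => ?_⟩
  have hP := Phi_nonneg n D θ
  have hR := RR_nonneg n D θ
  rw [change_eq, abs_mul, abs_of_nonneg (by positivity : 0 ≤ (n : ℝ)⁻¹)]
  refine mul_le_mul_of_nonneg_left ?_ (by positivity)
  have hsq : ∀ z : Fin D → ℝ, 0 ≤ ∑ α, z α ^ 2 := fun z => Finset.sum_nonneg fun _ _ => sq_nonneg _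
  have hnet : ∀ z, net1 n D θ z ^ 2 ≤ (∑ α, z α ^ 2) * (1 + Phi n D θ) := fun z => by
    have := net1_sq_le n D θ z
    have := hsq z
    linarith
  have hsplit : RR n D θ = (n : ℝ)⁻¹ * ∑ i, θ (Sum.inl i) ^ 2 +
      (n : ℝ)⁻¹ * ∑ i : Fin n, ∑ α : Fin D, θ (Sum.inr (i, α)) ^ 2 := by
    unfold RR
    rw [Fintype.sum_sum_type, Fintype.sum_prod_type, mul_add]
  have hU0 : 0 ≤ (n : ℝ)⁻¹ * ∑ i : Fin n, ∑ α : Fin D, θ (Sum.inr (i, α)) ^ 2 := by positivity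
  have hV0 : 0 ≤ (n : ℝ)⁻¹ * ∑ i, θ (Sum.inl i) ^ 2 := by positivity
  refine real_bound η _ _ _ _ _ _ _ _ _ _ A B _ _ (1 + W) hη.le (by linarith) hR
    (hA' n θ) (hB' n θ) (hnet x) (hnet x') ?_ hV0 (by linarith) (by positivity) ?_ hA hB (hsq x)
    (hsq x') (by positivity)
  · have h1 := net1_sq_le n D θ (ww n D Dtr θ)
    have h2 := hW' n θ
    have h3 := hsq (ww n D Dtr θ)
    have h4 : |net1 n D θ (ww n D Dtr θ)| ≤ (Phi n D θ + ∑ α, ww n D Dtr θ α ^ 2) := by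
      refine abs_le_of_sq_le_sq ?_ (by positivity)
      nlinarith
    nlinarith
  · have h2 := hW' n θ
    have h1 : (n : ℝ)⁻¹ * ∑ i, (∑ α, θ (Sum.inr (i, α)) * ww n D Dtr θ α) ^ 2 ≤
      ((n : ℝ)⁻¹ * ∑ i : Fin n, ∑ α : Fin D, θ (Sum.inr (i, α)) ^ 2) *
        ∑ α, ww n D Dtr θ α ^ 2 := by
      rw [mul_assoc, Finset.sum_mul]
      refine mul_le_mul_of_nonneg_left (Finset.sum_le_sum fun i _ => ?_) (by positivity)
      exact Finset.sum_mul_sq_le_sq_mul_sq _ _ _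
    refine h1.trans ?_
    have h3 : ((n : ℝ)⁻¹ * ∑ i : Fin n, ∑ α : Fin D, θ (Sum.inr (i, α)) ^ 2) *
        ∑ α, ww n D Dtr θ α ^ 2 ≤ RR n D θ * ((1 + W) * (1 + Phi n D θ)) := by
      refine mul_le_mul (by linarith) (by linarith) (hsq _) hR
    linarith

instance stdGaussian_isProb (ι : Type*) [Fintype ι] : IsProbabilityMeasure (_root_.stdGaussian ι) := by
  unfold _root_.stdGaussian
  infer_instance

/-- functions with all moments finite -/
def Nice {ι : Type*} [Fintype ι] (f : (ι → ℝ) → ℝ) : Prop :=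
  ∀ p : NNReal, MemLp f p (stdGaussian ι)

section nice
variable {ι : Type*} [Fintype ι]

theorem Nice.const (c : ℝ) : Nice (fun _ : ι → ℝ => c) := fun _ => memLp_const c

theorem Nice.add {f g : (ι → ℝ) → ℝ} (hf : Nice f) (hg : Nice g) : Nice (fun θ => f θ + g θ) :=
  fun p => (hf p).add (hg p)

theorem Nice.mul {f g : (ι → ℝ) → ℝ} (hf : Nice f) (hg : Nice g) : Nice (fun θ => f θ * g θ) := by
  intro p
  have : ENNReal.HolderTriple ((2 * p : NNReal) : ENNReal) ((2 * p : NNReal) : ENNReal) p := by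
    constructor
    rw [ENNReal.coe_mul, ENNReal.mul_inv (by simp) (by simp), ← add_mul]
    simp [ENNReal.inv_two_add_inv_two]
  exact (hg (2 * p)).mul' (hf (2 * p))

theorem Nice.pow {f : (ι → ℝ) → ℝ} (hf : Nice f) (k : ℕ) : Nice (fun θ => f θ ^ k) := by
  induction k with
  | zero => simpa using Nice.const 1
  | succ k ih => simpa only [pow_succ] using ih.mul hf

theorem Nice.sum {κ : Type*} (s : Finset κ) {f : κ → (ι → ℝ) → ℝ} (hf : ∀ k ∈ s, Nice (f k)) :
    Nice (fun θ => ∑ k ∈ s, f k θ) :=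
  fun p => memLp_finsetSum s fun k hk => hf k hk p

theorem evalMP (μ : ι) :
    MeasurePreserving (fun θ : ι → ℝ => θ μ) (stdGaussian ι) (gaussianReal 0 1) :=
  measurePreserving_eval _ μ

theorem Nice.coord (μ : ι) : Nice (fun θ : ι → ℝ => θ μ) := fun p =>
  (memLp_id_gaussianReal (μ := 0) (v := 1) p).comp_measurePreserving (evalMP μ)

theorem Nice.int {f : (ι → ℝ) → ℝ} (hf : Nice f) : Integrable f (stdGaussian ι) :=
  memLp_one_iff_integrable.1 (by simpa using hf 1)

/-- sixth moment -/
noncomputable def m6 : ℝ := ∫ t, t ^ 6 ∂(gaussianReal 0 1)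

theorem m6_nonneg : 0 ≤ m6 := integral_nonneg fun t => by positivity

theorem int_six (μ : ι) : ∫ θ, θ μ ^ 6 ∂(stdGaussian ι) = m6 := by
  unfold m6
  rw [← (evalMP μ).map_eq, integral_map (evalMP μ).measurable.aemeasurable]
  exact (by fun_prop : Measurable fun t : ℝ => t ^ 6).aestronglyMeasurable

/-- sign flip of one coordinate -/
noncomputable def flipc [DecidableEq ι] (ν : ι) (θ : ι → ℝ) : ι → ℝ :=
  fun μ => (if μ = ν then (fun t : ℝ => -t) else id) (θ μ)

theorem flip_mp [DecidableEq ι] (ν : ι) :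
    MeasurePreserving (flipc ν) (stdGaussian ι) (stdGaussian ι) := by
  refine measurePreserving_pi _ _ fun μ => ?_
  split_ifs
  · refine ⟨measurable_neg, ?_⟩
    simpa using gaussianReal_map_neg (μ := 0) (v := 1)
  · exact MeasurePreserving.id _

theorem int_flip [DecidableEq ι] (ν : ι) {f : (ι → ℝ) → ℝ} (hf : Nice f)
    (h : ∀ θ, f (flipc ν θ) = - f θ) : ∫ θ, f θ ∂(stdGaussian ι) = 0 := by
  have h1 : ∫ θ, f θ ∂(stdGaussian ι) = ∫ θ, f (flipc ν θ) ∂(stdGaussian ι) := by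
    conv_lhs => rw [← (flip_mp ν).map_eq]
    rw [integral_map (flip_mp ν).measurable.aemeasurable]
    rw [(flip_mp ν).map_eq]
    exact hf.int.aestronglyMeasurable
  simp only [h, integral_neg] at h1
  linarith

theorem amgm3 (a b c : ℝ) : a ^ 2 * b ^ 2 * c ^ 2 ≤ a ^ 6 + b ^ 6 + c ^ 6 := by
  have key : ∀ u v w : ℝ, 0 ≤ u → 0 ≤ v → 0 ≤ w → u * v * w ≤ u ^ 3 + v ^ 3 + w ^ 3 := by
    intro u v w hu hv hw
    have : 0 ≤ (u + v + w) * ((u - v) ^ 2 + (v - w) ^ 2 + (u - w) ^ 2) := by positivity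
    have : 0 ≤ u * v * w := by positivity
    nlinarith
  have := key (a ^ 2) (b ^ 2) (c ^ 2) (by positivity) (by positivity) (by positivity)
  calc _ ≤ _ := this
    _ = _ := by ring

theorem int_three (μ ν κ : ι) :
    ∫ θ, θ μ ^ 2 * θ ν ^ 2 * θ κ ^ 2 ∂(stdGaussian ι) ≤ 3 * m6 := by
  have h6 : ∀ a : ι, Integrable (fun θ : ι → ℝ => θ a ^ 6) (stdGaussian ι) :=
    fun a => ((Nice.coord a).pow 6).int
  have : ∫ θ, θ μ ^ 2 * θ ν ^ 2 * θ κ ^ 2 ∂(stdGaussian ι) ≤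
      ∫ θ, (θ μ ^ 6 + θ ν ^ 6 + θ κ ^ 6) ∂(stdGaussian ι) :=
    integral_mono ((((Nice.coord μ).pow 2).mul ((Nice.coord ν).pow 2)).mul
      ((Nice.coord κ).pow 2)).int (((h6 μ).add (h6 ν)).add (h6 κ)) fun θ => amgm3 _ _ _
  have h2 : Integrable (fun θ : ι → ℝ => θ μ ^ 6 + θ ν ^ 6) (stdGaussian ι) := (h6 μ).add (h6 ν)
  rw [integral_add h2 (h6 κ), integral_add (h6 μ) (h6 ν)] at this
  simp only [int_six] at this
  linarith

theorem int_two (ν κ : ι) :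
    ∫ θ, θ ν ^ 2 * θ κ ^ 2 ∂(stdGaussian ι) ≤ 1 + 2 * m6 := by
  have h6 : ∀ a : ι, Integrable (fun θ : ι → ℝ => θ a ^ 6) (stdGaussian ι) :=
    fun a => ((Nice.coord a).pow 6).int
  have h1 : Integrable (fun θ : ι → ℝ => (1 : ℝ)) (stdGaussian ι) := integrable_const _
  have : ∫ θ, θ ν ^ 2 * θ κ ^ 2 ∂(stdGaussian ι) ≤
      ∫ θ, (1 + θ ν ^ 6 + θ κ ^ 6) ∂(stdGaussian ι) :=
    integral_mono (((Nice.coord ν).pow 2).mul ((Nice.coord κ).pow 2)).int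
      ((h1.add (h6 ν)).add (h6 κ)) fun θ => by simpa using amgm3 1 (θ ν) (θ κ)
  have h2 : Integrable (fun θ : ι → ℝ => 1 + θ ν ^ 6) (stdGaussian ι) := h1.add (h6 ν)
  rw [integral_add h2 (h6 κ), integral_add h1 (h6 ν)] at this
  simp only [int_six] at this
  simp at this
  linarith

theorem int_one (κ : ι) :
    ∫ θ, θ κ ^ 2 ∂(stdGaussian ι) ≤ 2 + m6 := by
  have h6 : ∀ a : ι, Integrable (fun θ : ι → ℝ => θ a ^ 6) (stdGaussian ι) :=
    fun a => ((Nice.coord a).pow 6).int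
  have h1 : Integrable (fun θ : ι → ℝ => (2 : ℝ)) (stdGaussian ι) := integrable_const _
  have : ∫ θ, θ κ ^ 2 ∂(stdGaussian ι) ≤ ∫ θ, (2 + θ κ ^ 6) ∂(stdGaussian ι) :=
    integral_mono ((Nice.coord κ).pow 2).int (h1.add (h6 κ)) fun θ => by
      have := amgm3 1 1 (θ κ)
      norm_num at this ⊢
      linarith
  rw [integral_add h1 (h6 κ)] at this
  simp only [int_six] at this
  simp at this
  linarith
end nice

theorem nice_RR (n D : ℕ) : Nice (fun θ => RR n D θ) :=
  (Nice.const _).mul (Nice.sum _ fun μ _ => (Nice.coord μ).pow 2)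

theorem nice_FF (n D : ℕ) (α : Fin D) : Nice (fun θ => FF n D θ α) :=
  (Nice.const _).mul (Nice.sum _ fun i _ => (Nice.coord _).mul (Nice.coord _))

theorem flipc_sq {ι : Type*} [DecidableEq ι] (ν μ : ι) (θ : ι → ℝ) :
    flipc ν θ μ ^ 2 = θ μ ^ 2 := by
  unfold flipc
  split_ifs <;> simp

theorem flipc_RR (n D : ℕ) (ν) (θ) : RR n D (flipc ν θ) = RR n D θ := by
  unfold RR
  simp only [flipc_sq]

theorem cross_zero (n D : ℕ) (α : Fin D) (j k : Fin n) (h : k ≠ j) :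
    ∫ θ, (1 + RR n D θ) * ((θ (Sum.inl j) * θ (Sum.inr (j, α))) *
      (θ (Sum.inl k) * θ (Sum.inr (k, α)))) ∂(stdGaussian (Fin n ⊕ Fin n × Fin D)) = 0 := by
  refine int_flip (Sum.inl j) (((Nice.const 1).add (nice_RR n D)).mul
    (((Nice.coord _).mul (Nice.coord _)).mul ((Nice.coord _).mul (Nice.coord _)))) fun θ => ?_
  rw [flipc_RR]
  simp [flipc, h]

theorem card_bound (n D : ℕ) (C : ℝ) (hC : 0 ≤ C) :
    (n : ℝ)⁻¹ * ∑ _μ : Fin n ⊕ Fin n × Fin D, C ≤ (1 + D) * C := by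
  simp only [Finset.sum_const, Finset.card_univ, Fintype.card_sum, Fintype.card_prod,
    Fintype.card_fin, nsmul_eq_mul]
  rcases Nat.eq_zero_or_pos n with rfl | hn
  · simp
    positivity
  · have : (n : ℝ) ≠ 0 := by positivity
    push_cast
    refine le_of_eq ?_
    field_simp

theorem diag_le (n D : ℕ) (α : Fin D) (j : Fin n) :
    ∫ θ, (1 + RR n D θ) * ((θ (Sum.inl j) * θ (Sum.inr (j, α))) *
      (θ (Sum.inl j) * θ (Sum.inr (j, α)))) ∂(stdGaussian (Fin n ⊕ Fin n × Fin D)) ≤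
      (1 + 2 * m6) + (1 + D) * (3 * m6) := by
  have h : ∀ θ : Fin n ⊕ Fin n × Fin D → ℝ,
      (1 + RR n D θ) * ((θ (Sum.inl j) * θ (Sum.inr (j, α))) *
      (θ (Sum.inl j) * θ (Sum.inr (j, α)))) = θ (Sum.inl j) ^ 2 * θ (Sum.inr (j, α)) ^ 2 +
      (n : ℝ)⁻¹ * ∑ μ, θ μ ^ 2 * θ (Sum.inl j) ^ 2 * θ (Sum.inr (j, α)) ^ 2 := by
    intro θ
    unfold RR
    rw [← Finset.sum_mul, ← Finset.sum_mul]
    ring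
  simp only [h]
  have n1 : Nice (fun θ : Fin n ⊕ Fin n × Fin D → ℝ =>
      θ (Sum.inl j) ^ 2 * θ (Sum.inr (j, α)) ^ 2) :=
    ((Nice.coord _).pow 2).mul ((Nice.coord _).pow 2)
  have n2 : ∀ μ ∈ Finset.univ, Nice (fun θ : Fin n ⊕ Fin n × Fin D → ℝ =>
      θ μ ^ 2 * θ (Sum.inl j) ^ 2 * θ (Sum.inr (j, α)) ^ 2) :=
    fun μ _ => (((Nice.coord _).pow 2).mul ((Nice.coord _).pow 2)).mul ((Nice.coord _).pow 2)
  rw [integral_add n1.int ((Nice.const _).mul (Nice.sum _ n2)).int, integral_const_mul,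
    integral_finsetSum _ fun μ hμ => (n2 μ hμ).int]
  refine add_le_add (int_two _ _) ?_
  refine le_trans ?_ (card_bound n D (3 * m6) (by linarith [m6_nonneg]))
  exact mul_le_mul_of_nonneg_left (Finset.sum_le_sum fun μ _ => int_three _ _ _) (by positivity)

theorem FF_le (n D : ℕ) (α : Fin D) :
    ∫ θ, (1 + RR n D θ) * FF n D θ α ^ 2 ∂(stdGaussian (Fin n ⊕ Fin n × Fin D)) ≤
      (1 + 2 * m6) + (1 + D) * (3 * m6) := by
  have h : ∀ θ : Fin n ⊕ Fin n × Fin D → ℝ, (1 + RR n D θ) * FF n D θ α ^ 2 =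
      (n : ℝ)⁻¹ * ∑ j, ∑ k, (1 + RR n D θ) * ((θ (Sum.inl j) * θ (Sum.inr (j, α))) *
      (θ (Sum.inl k) * θ (Sum.inr (k, α)))) := by
    intro θ
    unfold FF
    simp only [← Finset.mul_sum]
    rw [← Finset.sum_mul, mul_pow, csq]
    ring
  have n2 : ∀ j k : Fin n, Nice (fun θ : Fin n ⊕ Fin n × Fin D → ℝ =>
      (1 + RR n D θ) * ((θ (Sum.inl j) * θ (Sum.inr (j, α))) *
      (θ (Sum.inl k) * θ (Sum.inr (k, α))))) := fun j k =>
    (((Nice.const 1).add (nice_RR n D)).mul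
    (((Nice.coord _).mul (Nice.coord _)).mul ((Nice.coord _).mul (Nice.coord _))))
  simp only [h]
  rw [integral_const_mul, integral_finsetSum _ fun j _ => (Nice.sum _ fun k _ => n2 j k).int]
  have h2 : ∀ j : Fin n, ∫ θ, ∑ k, (1 + RR n D θ) * ((θ (Sum.inl j) * θ (Sum.inr (j, α))) *
      (θ (Sum.inl k) * θ (Sum.inr (k, α)))) ∂(stdGaussian (Fin n ⊕ Fin n × Fin D)) ≤
      (1 + 2 * m6) + (1 + D) * (3 * m6) := by
    intro j
    rw [integral_finsetSum _ fun k _ => (n2 j k).int,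
      Finset.sum_eq_single j (fun k _ hk => cross_zero n D α j k hk) (by simp)]
    exact diag_le n D α j
  have hC : 0 ≤ (1 + 2 * m6) + (1 + D) * (3 * m6) := by
    have := m6_nonneg
    positivity
  refine (mul_le_mul_of_nonneg_left (Finset.sum_le_sum fun j _ => h2 j) (by positivity)).trans ?_
  have := card_bound n 0 _ hC
  simpa using this

theorem nice_bound (n D : ℕ) : Nice (fun θ => (1 + RR n D θ) * (1 + Phi n D θ)) :=
  ((Nice.const 1).add (nice_RR n D)).mul
    ((Nice.const 1).add (Nice.sum _ fun α _ => (nice_FF n D α).pow 2))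

theorem bound_le (n D : ℕ) :
    ∫ θ, (1 + RR n D θ) * (1 + Phi n D θ) ∂(stdGaussian (Fin n ⊕ Fin n × Fin D)) ≤
      1 + (1 + D) * (2 + m6) + D * ((1 + 2 * m6) + (1 + D) * (3 * m6)) := by
  have h : ∀ θ : Fin n ⊕ Fin n × Fin D → ℝ, (1 + RR n D θ) * (1 + Phi n D θ) =
      (1 + RR n D θ) + ∑ α, (1 + RR n D θ) * FF n D θ α ^ 2 := by
    intro θ
    unfold Phi
    rw [← Finset.mul_sum]
    ring
  have n1 : Nice (fun θ : Fin n ⊕ Fin n × Fin D → ℝ => 1 + RR n D θ) :=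
    (Nice.const 1).add (nice_RR n D)
  have n2 : ∀ α, Nice (fun θ : Fin n ⊕ Fin n × Fin D → ℝ =>
    (1 + RR n D θ) * FF n D θ α ^ 2) := fun α => n1.mul ((nice_FF n D α).pow 2)
  simp only [h]
  rw [integral_add n1.int (Nice.sum _ fun α _ => n2 α).int,
    integral_add (Nice.const 1).int (nice_RR n D).int,
    integral_finsetSum _ fun α _ => (n2 α).int]
  refine add_le_add (add_le_add (by simp) ?_) ?_
  · unfold RR
    rw [integral_const_mul, integral_finsetSum _ fun μ _ => ((Nice.coord μ).pow 2).int]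
    refine le_trans ?_ (card_bound n D (2 + m6) (by linarith [m6_nonneg]))
    exact mul_le_mul_of_nonneg_left (Finset.sum_le_sum fun μ _ => int_one _) (by positivity)
  · refine (Finset.sum_le_sum fun α _ => FF_le n D α).trans ?_
    simp
    linarith

/-- For the one-hidden-layer linear network with standard Gaussian initialization, the
expected change of the NTK after a single gradient descent step on the MSE loss is
`O(n⁻¹)` as the width `n → ∞`. -/
theorem ntk_change_one_step_isBigO (D : ℕ) (η : ℝ) (hη : 0 < η)
    (Dtr : Finset ((Fin D → ℝ) × ℝ)) (x x' : Fin D → ℝ) :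
    (fun n : ℕ =>
        ∫ θ, (ntk1 n D (gdStep n D η Dtr θ) x x' - ntk1 n D θ x x')
          ∂(stdGaussian (Fin n ⊕ Fin n × Fin D)))
      =O[atTop] (fun n : ℕ => (n : ℝ)⁻¹) := by
  obtain ⟨K, hK, hb⟩ := change_le D η hη Dtr x x'
  refine IsBigO.of_bound
    (K * (1 + (1 + D) * (2 + m6) + D * ((1 + 2 * m6) + (1 + D) * (3 * m6)))) ?_
  refine Eventually.of_forall fun n => ?_
  have hi := (((Nice.const (n : ℝ)⁻¹).mul ((Nice.const K).mul (nice_bound n D)))).int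
  refine (norm_integral_le_of_norm_le hi (Eventually.of_forall fun θ => hb n θ)).trans ?_
  rw [integral_const_mul, integral_const_mul, Real.norm_of_nonneg (by positivity), mul_comm]
  exact mul_le_mul_of_nonneg_right (mul_le_mul_of_nonneg_left (bound_le n D) hK) (by positivity)
end
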